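/- For all κ > 0 and λ > 0 there exists τ > 0 such that every compact metric measure space (X, υ) with X a geodesic space, satisfying the doubling condition for κ and the segment inequality for λ, satisfies the (1, 1)-Poincaré inequality for τ. -/

import Mathlib

open MeasureTheory Metric Filter Set
open scoped Topology NNReal ENNReal
open Classical

variable {X : Type*} [MetricSpace X]

/-- A real-valued function is Lipschitz (with some constant). -/
def IsLipFun (f : X → ℝ) : Prop := ∃ K : ℝ≥0, LipschitzWith K f

/-- The pointwise Lipschitz constant `Lip f (x)`:
`0` if `x` is isolated, and otherwise the limit (= infimum, by monotonicity)
as `r → 0` of `sup_{y ∈ B_r(x), y ≠ x} |f x - f y| / dist x y`. -/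
noncomputable def pLip (f : X → ℝ) (x : X) : ℝ :=
  if 𝓝[≠] x = ⊥ then 0
  else ⨅ r : Ioi (0:ℝ), sSup ((fun y => |f x - f y| / dist x y) '' (ball x r.1 \ {x}))

/-- `γ` is a (unit-speed) minimal geodesic from `x` to `y`. -/
def IsMinGeodesic (γ : ℝ → X) (x y : X) : Prop :=
  γ 0 = x ∧ γ (dist x y) = y ∧
    ∀ s ∈ Icc (0:ℝ) (dist x y), ∀ t ∈ Icc (0:ℝ) (dist x y), dist (γ s) (γ t) = |s - t|

/-- A metric space is geodesic if any two points are joined by a minimal geodesic. -/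
def IsGeodesicSpace (Y : Type*) [MetricSpace Y] : Prop :=
  ∀ x y : Y, ∃ γ : ℝ → Y, IsMinGeodesic γ x y

section MeasureDefs
variable [MeasurableSpace X] (υ : Measure X)

/-- The doubling condition for `κ`. -/
def DoublingFor (κ : ℝ) : Prop :=
  ∀ x : X, ∀ r : ℝ, 0 < r → υ (ball x (2*r)) ≤ (2:ℝ≥0∞) ^ κ * υ (ball x r)

/-- The `(q,p)`-Poincaré inequality for `τ` (for Lipschitz functions). -/
def PoincareFor (q p τ : ℝ) : Prop :=
  ∀ x : X, ∀ r : ℝ, 0 < r → ∀ f : X → ℝ, IsLipFun f →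
    (⨍ y in ball x r, |f y - ⨍ z in ball x r, f z ∂υ| ^ q ∂υ) ^ (1/q) ≤
      τ * r * ((⨍ y in ball x r, (pLip f y) ^ p ∂υ) ^ (1/p))

/-- `F_g(x,y)`: the infimum over minimal geodesics `γ` from `x` to `y` of
`∫_0^{d(x,y)} g(γ(s)) ds`. -/
noncomputable def segF (g : X → ℝ≥0∞) (x y : X) : ℝ≥0∞ :=
  ⨅ γ ∈ {γ : ℝ → X | IsMinGeodesic γ x y}, ∫⁻ s in Icc (0:ℝ) (dist x y), g (γ s)

/-- The segment inequality for `lam`. -/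
def SegmentIneqFor (lam : ℝ) : Prop :=
  ∀ x : X, ∀ r : ℝ, 0 < r → ∀ g : X → ℝ≥0∞, Measurable g →
    (∫⁻ pr in (ball x r) ×ˢ (ball x r), segF g pr.1 pr.2 ∂(υ.prod υ)) ≤
      ENNReal.ofReal (lam * r) * υ (ball x r) * ∫⁻ z in ball x (3*r), g z ∂υ

/-- The first eigenvalue of the `p`-Laplacian (`∞` if there is no competitor). -/
noncomputable def lambda1 (p : ℝ) : ℝ≥0∞ :=
  ⨅ f ∈ {f : X → ℝ | IsLipFun f ∧ (∫ x, |f x| ^ p ∂υ) = 1 ∧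
      (∫ x, |f x| ^ (p-2) * f x ∂υ) = 0},
    ENNReal.ofReal (∫ x, (pLip f x) ^ p ∂υ)

/-- Minkowski's exterior boundary measure
`υ⁺(A) = liminf_{r → 0+} (υ(B_r(A)) - υ(A))/r`. -/
noncomputable def minkBoundary (A : Set X) : ℝ≥0∞ :=
  Filter.liminf (fun r : ℝ => (υ (thickening r A) - υ A) / ENNReal.ofReal r) (𝓝[>] (0:ℝ))

/-- The Cheeger constant (`∞` if there is no competitor). -/
noncomputable def cheeger : ℝ≥0∞ :=
  ⨅ A ∈ {A : Set X | MeasurableSet A ∧ 0 < υ A ∧ υ A ≤ 1/2}, minkBoundary υ A / υ A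

/-- `λ_{1,p}` for `p ∈ [1, ∞)`, with `λ_{1,1} := h(X)` the Cheeger constant. -/
noncomputable def lam1 (p : ℝ) : ℝ≥0∞ := if p = 1 then cheeger υ else lambda1 υ p

/-- `c_p(f) = inf_{c ∈ ℝ} (∫ |f - c|^p dυ)^{1/p}`. -/
noncomputable def cP (p : ℝ) (f : X → ℝ) : ℝ :=
  ⨅ c : ℝ, (∫ x, |f x - c| ^ p ∂υ) ^ (1/p)

/-- `M` is a median of `f`. -/
def IsMedian (f : X → ℝ) (M : ℝ) : Prop :=
  (1/2 : ℝ≥0∞) ≤ υ {x | M ≤ f x} ∧ (1/2 : ℝ≥0∞) ≤ υ {x | f x ≤ M}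

end MeasureDefs

/-- The global Lipschitz constant `sup_{a ≠ b} |f a - f b| / dist a b`. -/
noncomputable def globalLip (f : X → ℝ) : ℝ :=
  sSup {L : ℝ | ∃ a b : X, a ≠ b ∧ L = |f a - f b| / dist a b}



/-- A compact metric space contains finite maximal `ε`-separated subsets of any given set. -/
lemma exists_finset_separated_net [CompactSpace X] (s : Set X) {ε : ℝ} (hε : 0 < ε) :
    ∃ N : Finset X, (∀ y ∈ N, y ∈ s) ∧ (∀ y ∈ N, ∀ z ∈ N, y ≠ z → ε ≤ dist y z) ∧
      ∀ x ∈ s, ∃ y ∈ N, dist x y < ε := by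
  obtain ⟨N, hN⟩ := zorn_subset {N : Set X | N ⊆ s ∧ N.Pairwise fun y z => ε ≤ dist y z} (by
    intro c hc hchain
    refine ⟨⋃₀ c, ⟨sUnion_subset fun t ht => (hc ht).1, ?_⟩, fun t ht => subset_sUnion_of_mem ht⟩
    exact (pairwise_sUnion hchain.directedOn).2 fun t ht => (hc ht).2)
  have hfin : N.Finite := by
    obtain ⟨F, -, hFfin, hF⟩ := finite_cover_balls_of_compact (isCompact_univ (X := X))
      (half_pos hε)
    have hF' : ∀ y : X, ∃ z ∈ F, dist y z < ε / 2 := fun y => by simpa using hF (mem_univ y)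
    choose φ hφF hφ using hF'
    refine Set.Finite.of_finite_image (f := φ) (hFfin.subset ?_) ?_
    · rintro _ ⟨y, -, rfl⟩
      exact hφF y
    · intro y hy z hz hyz
      by_contra hne
      have h1 := hN.prop.2 hy hz hne
      have h2 := dist_triangle_right y z (φ y)
      have h3 := hφ y
      have h4 := hφ z
      rw [← hyz] at h4
      linarith
  refine ⟨hfin.toFinset, fun y hy => hN.prop.1 (by simpa using hy),
    fun y hy z hz => hN.prop.2 (by simpa using hy) (by simpa using hz), fun x hx => ?_⟩
  by_contra! hcon
  have hxN : x ∉ N := fun h => by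
    have := hcon x (by simpa using h)
    simp at this
    linarith
  refine hxN (hN.le_of_ge (y := insert x N) ⟨insert_subset hx hN.prop.1, ?_⟩
    (subset_insert x N) (mem_insert x N))
  refine hN.prop.2.insert fun y hy _ => ?_
  have := hcon y (by simpa using hy)
  exact ⟨this, by rwa [dist_comm]⟩

/-- If `f` is close on average to `a` on `U` and to `b` on `V`, and `S ⊆ U ∩ V` has comparable
measure, then `a` is close to `b`. -/
lemma enorm_sub_le_of_subset {α : Type*} [MeasurableSpace α] {υ : Measure α} {f : α → ℝ} (hf : Measurable f) {a b : ℝ} {S U V : Set α}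
    {C : ℝ≥0∞} (hSU : S ⊆ U) (hSV : S ⊆ V) (hS : υ S ≠ 0) (hST : υ S ≠ ⊤)
    (hCU : υ U ≤ C * υ S) (hCV : υ V ≤ C * υ S) (hUT : υ U ≠ ⊤) (hVT : υ V ≠ ⊤) :
    ‖a - b‖ₑ ≤ C * ((∫⁻ y in U, ‖f y - a‖ₑ ∂υ) / υ U + (∫⁻ y in V, ‖f y - b‖ₑ ∂υ) / υ V) := by
  have hU0 : υ U ≠ 0 := fun h => hS (measure_mono_null hSU h)
  have hV0 : υ V ≠ 0 := fun h => hS (measure_mono_null hSV h)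
  have key : ∀ {W : Set α} {I : ℝ≥0∞}, υ W ≤ C * υ S → υ W ≠ 0 → υ W ≠ ⊤ →
      I ≤ C * (I / υ W) * υ S := by
    intro W I hW hW0 hWT
    calc I = I / υ W * υ W := (ENNReal.div_mul_cancel hW0 hWT).symm
      _ ≤ I / υ W * (C * υ S) := by gcongr
      _ = C * (I / υ W) * υ S := by ring
  refine (ENNReal.mul_le_mul_iff_left hS hST).1 ?_
  calc ‖a - b‖ₑ * υ S = ∫⁻ _ in S, ‖a - b‖ₑ ∂υ := (setLIntegral_const _ _).symm
    _ ≤ ∫⁻ y in S, (‖f y - a‖ₑ + ‖f y - b‖ₑ) ∂υ := by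
        refine lintegral_mono fun y => ?_
        have h : a - b = (f y - b) - (f y - a) := by ring
        rw [h, add_comm]
        exact enorm_sub_le
    _ = ∫⁻ y in S, ‖f y - a‖ₑ ∂υ + ∫⁻ y in S, ‖f y - b‖ₑ ∂υ :=
        lintegral_add_left (hf.sub_const a).enorm _
    _ ≤ ∫⁻ y in U, ‖f y - a‖ₑ ∂υ + ∫⁻ y in V, ‖f y - b‖ₑ ∂υ := by
        gcongr
    _ ≤ C * ((∫⁻ y in U, ‖f y - a‖ₑ ∂υ) / υ U) * υ S +
          C * ((∫⁻ y in V, ‖f y - b‖ₑ ∂υ) / υ V) * υ S :=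
        add_le_add (key hCU hU0 hUT) (key hCV hV0 hVT)
    _ = _ := by ring

lemma setLIntegral_biUnion_finset_le {α ι : Type*} [MeasurableSpace α] {υ : Measure α}
    (N : Finset ι) (s : ι → Set α) (f : α → ℝ≥0∞) :
    ∫⁻ w in ⋃ i ∈ N, s i, f w ∂υ ≤ ∑ i ∈ N, ∫⁻ w in s i, f w ∂υ := by
  have h : ⋃ i ∈ N, s i = ⋃ i : N, s i := biUnion_eq_iUnion _ _
  rw [h, ← Finset.sum_coe_sort, ← tsum_fintype (L := .unconditional _)]
  exact lintegral_iUnion_le _ _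

/-- The radii of the balls in the chain from the centre of a ball of radius `r` to its boundary. -/
noncomputable def chainRadius (r : ℝ) (j : ℕ) : ℝ := (5 / 6) ^ j * (r / 3)

lemma chainRadius_pos {r : ℝ} (hr : 0 < r) (j : ℕ) : 0 < chainRadius r j := by
  unfold chainRadius; positivity

lemma chainRadius_succ (r : ℝ) (j : ℕ) : chainRadius r (j + 1) = 5 / 6 * chainRadius r j := by
  unfold chainRadius; ring

lemma chainRadius_zero (r : ℝ) : chainRadius r 0 = r / 3 := by
  simp [chainRadius]

lemma chainRadius_antitone {r : ℝ} (hr : 0 < r) : Antitone (chainRadius r) :=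
  antitone_nat_of_succ_le fun j => by
    rw [chainRadius_succ]
    linarith [chainRadius_pos hr j]

lemma sum_chainRadius_le {r : ℝ} (hr : 0 < r) (n : ℕ) :
    ∑ j ∈ Finset.range n, chainRadius r j ≤ 2 * r := by
  have : ∀ n, ∑ j ∈ Finset.range n, chainRadius r j = 2 * r - 6 * chainRadius r n := by
    intro n
    induction n with
    | zero => simp [chainRadius_zero]; ring
    | succ n ih => rw [Finset.sum_range_succ, ih, chainRadius_succ]; ring
  rw [this]
  linarith [chainRadius_pos hr n]


/-- In a geodesic space, every point of a ball is joined to the centre by a chain of points of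
prescribed nets. -/
lemma exists_chain (hX : IsGeodesicSpace X) {x : X} {r : ℝ} (hr : 0 < r) {N : ℕ → Finset X}
    (hN : ∀ j, ∀ p, dist x p ≤ r - 3 * chainRadius r j →
      ∃ z ∈ N j, dist p z < chainRadius r j / 8)
    (K : ℕ) {y : X} (hy : dist x y ≤ r - 3 * chainRadius r K) :
    ∃ a : ℕ → X, (∀ j, a j ∈ N j) ∧ (∀ j, dist y (a j) ≤ 3 * chainRadius r j + chainRadius r j / 8) ∧
      dist y (a K) < chainRadius r K / 8 ∧
      ∀ j, dist (a j) (a (j + 1)) ≤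
        chainRadius r j / 2 + chainRadius r j / 8 + chainRadius r (j + 1) / 8 := by
  obtain ⟨γ, hγ0, hγ1, hγ⟩ := hX x y
  set d := dist x y with hd
  have hd0 : 0 ≤ d := dist_nonneg
  have hle : ∀ j, 0 ≤ r - 3 * chainRadius r j := fun j => by
    have := chainRadius_antitone hr (Nat.zero_le j)
    rw [chainRadius_zero] at this
    linarith
  set t : ℕ → ℝ := fun j => min d (r - 3 * chainRadius r j) with ht
  have htm : ∀ j, t j ∈ Icc 0 d := fun j => ⟨le_min hd0 (hle j), min_le_left _ _⟩
  have hp : ∀ j, dist x (γ (t j)) ≤ r - 3 * chainRadius r j := fun j => by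
    conv_lhs => rw [← hγ0]
    rw [hγ 0 ⟨le_rfl, hd0⟩ _ (htm j), zero_sub, abs_neg, abs_of_nonneg (htm j).1]
    exact min_le_right _ _
  choose a haN ha using fun j => hN j _ (hp j)
  refine ⟨a, haN, fun j => ?_, ?_, fun j => ?_⟩
  · have h1 : dist y (γ (t j)) ≤ 3 * chainRadius r j := by
      conv_lhs => rw [← hγ1]
      rw [hγ d ⟨hd0, le_rfl⟩ _ (htm j), abs_of_nonneg (sub_nonneg.2 (htm j).2)]
      have h3 := chainRadius_pos hr j
      have h4 := chainRadius_pos hr K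
      rcases min_cases d (r - 3 * chainRadius r j) with h | h <;> simp only [ht, h.1] <;> linarith
    linarith [dist_triangle y (γ (t j)) (a j), ha j]
  · have h1 : t K = d := min_eq_left hy
    have h2 := ha K
    rwa [h1, hγ1] at h2
  · have h1 : dist (γ (t j)) (γ (t (j + 1))) ≤ chainRadius r j / 2 := by
      rw [hγ _ (htm j) _ (htm (j + 1))]
      refine (abs_min_sub_min_le_max _ _ _ _).trans ?_
      have h3 := chainRadius_pos hr j
      rw [chainRadius_succ, sub_self, abs_zero]
      refine max_le (by linarith) (abs_le.2 ⟨?_, ?_⟩) <;> linarith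
    have h2 := dist_triangle4 (a j) (γ (t j)) (γ (t (j + 1))) (a (j + 1))
    have h3 := ha j
    rw [dist_comm] at h3
    linarith [ha (j + 1)]

section Doubling

variable [MeasurableSpace X] {υ : Measure X} {D : ℝ≥0∞}

lemma measure_ball_two_pow_le (hD : ∀ x : X, ∀ r : ℝ, 0 < r → υ (ball x (2 * r)) ≤ D * υ (ball x r))
    (x : X) {r : ℝ} (hr : 0 < r) (n : ℕ) : υ (ball x (2 ^ n * r)) ≤ D ^ n * υ (ball x r) := by
  induction n with
  | zero => simp
  | succ n ih =>
    calc υ (ball x (2 ^ (n + 1) * r)) = υ (ball x (2 * (2 ^ n * r))) := by ring_nf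
      _ ≤ D * υ (ball x (2 ^ n * r)) := hD _ _ (by positivity)
      _ ≤ D * (D ^ n * υ (ball x r)) := by gcongr
      _ = D ^ (n + 1) * υ (ball x r) := by ring

lemma measure_ball_le_of_dist_add_le
    (hD : ∀ x : X, ∀ r : ℝ, 0 < r → υ (ball x (2 * r)) ≤ D * υ (ball x r))
    {x y : X} {s t : ℝ} (ht : 0 < t) (n : ℕ) (h : s + dist x y ≤ 2 ^ n * t) :
    υ (ball x s) ≤ D ^ n * υ (ball y t) :=
  (measure_mono (ball_subset_ball' h)).trans (measure_ball_two_pow_le hD y ht n)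

lemma measure_ball_pos_of_doubling [CompactSpace X] [NeZero υ]
    (hD : ∀ x : X, ∀ r : ℝ, 0 < r → υ (ball x (2 * r)) ≤ D * υ (ball x r))
    (x : X) {r : ℝ} (hr : 0 < r) : υ (ball x r) ≠ 0 := by
  intro h0
  have hb : Bornology.IsBounded (univ : Set X) := isCompact_univ.isBounded
  obtain ⟨M, hM⟩ := hb.subset_ball x
  obtain ⟨n, hn⟩ := pow_unbounded_of_one_lt (M / r) one_lt_two
  have h1 : (univ : Set X) ⊆ ball x (2 ^ n * r) :=
    hM.trans (ball_subset_ball ((div_lt_iff₀ hr).1 hn).le)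
  have h2 := (measure_mono h1).trans (measure_ball_two_pow_le hD x hr n)
  rw [h0, mul_zero] at h2
  exact NeZero.ne υ (Measure.measure_univ_eq_zero.1 (le_antisymm h2 bot_le))

/-- Telescoping along a chain of balls: the deviation of `f` from the constant of the first ball,
on a small ball near the end of the chain. -/
lemma setLIntegral_enorm_sub_le_sum_chain [CompactSpace X] [NeZero υ] [IsFiniteMeasure υ]
    (hD : ∀ x : X, ∀ r : ℝ, 0 < r → υ (ball x (2 * r)) ≤ D * υ (ball x r))
    {f : X → ℝ} (hf : Measurable f) (m : X → ℝ → ℝ) {r : ℝ} (hr : 0 < r) {a : ℕ → X} {y : X}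
    (K : ℕ) (hyK : dist y (a K) < chainRadius r K / 8)
    (ha : ∀ j, dist (a j) (a (j + 1)) ≤
        chainRadius r j / 2 + chainRadius r j / 8 + chainRadius r (j + 1) / 8) :
    ∫⁻ w in ball y (chainRadius r K / 8), ‖f w - m (a 0) (chainRadius r 0)‖ₑ ∂υ ≤
      υ (ball y (chainRadius r K / 8)) * (3 * D ^ 5 * ∑ j ∈ Finset.range (K + 1),
        (∫⁻ w in ball (a j) (chainRadius r j), ‖f w - m (a j) (chainRadius r j)‖ₑ ∂υ) /
          υ (ball (a j) (chainRadius r j))) := by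
  set R := chainRadius r with hR
  set c : ℕ → ℝ := fun j => m (a j) (R j) with hc
  set E : ℕ → ℝ≥0∞ := fun j => (∫⁻ w in ball (a j) (R j), ‖f w - c j‖ₑ ∂υ) /
    υ (ball (a j) (R j)) with hE
  have hRpos : ∀ j, 0 < R j := chainRadius_pos hr
  have hstep : ∀ j, ‖c (j + 1) - c j‖ₑ ≤ D ^ 5 * (E (j + 1) + E j) := by
    intro j
    have h1 := hRpos j
    have h2 : R (j + 1) = 5 / 6 * R j := chainRadius_succ r j
    have h3 := ha j
    rw [h2] at h3
    refine enorm_sub_le_of_subset (S := ball (a (j + 1)) (R (j + 1) / 8)) hf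
      (ball_subset_ball (by linarith)) (ball_subset_ball' ?_)
      (measure_ball_pos_of_doubling hD _ (by linarith)) (measure_ne_top _ _)
      (measure_ball_le_of_dist_add_le hD (by linarith) 5 ?_)
      (measure_ball_le_of_dist_add_le hD (by linarith) 5 ?_)
      (measure_ne_top _ _) (measure_ne_top _ _)
    · rw [dist_comm]; linarith
    · rw [dist_self]; linarith
    · linarith
  have htel : ∀ k, ‖c k - c 0‖ₑ + D ^ 5 * E k ≤ 2 * D ^ 5 * ∑ j ∈ Finset.range (k + 1), E j := by
    intro k
    induction k with
    | zero =>
      simp only [sub_self, enorm_zero, zero_add, Finset.sum_range_one]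
      gcongr
      exact le_mul_of_one_le_left bot_le one_le_two
    | succ k ih =>
      rw [Finset.sum_range_succ, mul_add]
      calc ‖c (k + 1) - c 0‖ₑ + D ^ 5 * E (k + 1)
          ≤ (‖c (k + 1) - c k‖ₑ + ‖c k - c 0‖ₑ) + D ^ 5 * E (k + 1) := by
            gcongr
            rw [← sub_add_sub_cancel (c (k + 1)) (c k) (c 0)]
            exact enorm_add_le _ _
        _ ≤ (D ^ 5 * (E (k + 1) + E k) + ‖c k - c 0‖ₑ) + D ^ 5 * E (k + 1) := by
            gcongr
            exact hstep k
        _ = (‖c k - c 0‖ₑ + D ^ 5 * E k) + 2 * D ^ 5 * E (k + 1) := by ring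
        _ ≤ _ := by gcongr
  have hlast : ∫⁻ w in ball y (R K / 8), ‖f w - c K‖ₑ ∂υ ≤
      υ (ball y (R K / 8)) * (D ^ 5 * E K) := by
    have h1 := hRpos K
    have hsub : ball y (R K / 8) ⊆ ball (a K) (R K) := ball_subset_ball' (by linarith)
    have h0 : υ (ball (a K) (R K)) ≠ 0 := measure_ball_pos_of_doubling hD _ h1
    calc ∫⁻ w in ball y (R K / 8), ‖f w - c K‖ₑ ∂υ
        ≤ ∫⁻ w in ball (a K) (R K), ‖f w - c K‖ₑ ∂υ := lintegral_mono_set hsub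
      _ = E K * υ (ball (a K) (R K)) :=
          (ENNReal.div_mul_cancel h0 (measure_ne_top _ _)).symm
      _ ≤ E K * (D ^ 5 * υ (ball y (R K / 8))) := by
          gcongr
          refine measure_ball_le_of_dist_add_le hD (by linarith) 5 ?_
          rw [dist_comm]
          linarith
      _ = _ := by ring
  calc ∫⁻ w in ball y (R K / 8), ‖f w - c 0‖ₑ ∂υ
      ≤ ∫⁻ w in ball y (R K / 8), (‖f w - c K‖ₑ + ‖c K - c 0‖ₑ) ∂υ := by
        refine lintegral_mono fun w => ?_
        rw [← sub_add_sub_cancel (f w) (c K) (c 0)]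
        exact enorm_add_le _ _
    _ = ∫⁻ w in ball y (R K / 8), ‖f w - c K‖ₑ ∂υ + ‖c K - c 0‖ₑ * υ (ball y (R K / 8)) := by
        rw [lintegral_add_right _ measurable_const, setLIntegral_const]
    _ ≤ υ (ball y (R K / 8)) * (D ^ 5 * E K) + ‖c K - c 0‖ₑ * υ (ball y (R K / 8)) := by
        gcongr
    _ = υ (ball y (R K / 8)) * (‖c K - c 0‖ₑ + D ^ 5 * E K) := by ring
    _ ≤ υ (ball y (R K / 8)) * (2 * D ^ 5 * ∑ j ∈ Finset.range (K + 1), E j) := by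
        gcongr
        exact htel K
    _ ≤ _ := by
        gcongr
        norm_num

variable [BorelSpace X]

/-- Balls of radius `ε` around an `ε`-separated set have total mass controlled by the mass of
any ball containing the concentric half balls. -/
lemma sum_measure_ball_le_of_separated
    (hD : ∀ x : X, ∀ r : ℝ, 0 < r → υ (ball x (2 * r)) ≤ D * υ (ball x r))
    {N : Finset X} {ε : ℝ} (hε : 0 < ε) (hN : ∀ y ∈ N, ∀ z ∈ N, y ≠ z → ε ≤ dist y z)
    {w : X} {t : ℝ} (hw : ∀ y ∈ N, ε / 2 + dist y w ≤ t) :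
    ∑ y ∈ N, υ (ball y ε) ≤ D * υ (ball w t) := by
  calc ∑ y ∈ N, υ (ball y ε) ≤ ∑ y ∈ N, D * υ (ball y (ε / 2)) := by
        refine Finset.sum_le_sum fun y _ => ?_
        have := hD y (ε / 2) (by positivity)
        rwa [mul_div_cancel₀ _ two_ne_zero] at this
    _ = D * υ (⋃ y ∈ N, ball y (ε / 2)) := by
        rw [measure_biUnion_finset _ fun _ _ => measurableSet_ball, Finset.mul_sum]
        intro y hy z hz hyz
        exact ball_disjoint_ball (by linarith [hN y hy z hz hyz])
    _ ≤ D * υ (ball w t) := by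
        gcongr
        exact iUnion₂_subset fun y hy => ball_subset_ball' (hw y hy)

/-- Bounded overlap for balls centred on a separated set. -/
lemma card_separated_le [CompactSpace X] [NeZero υ] [IsFiniteMeasure υ]
    (hD : ∀ x : X, ∀ r : ℝ, 0 < r → υ (ball x (2 * r)) ≤ D * υ (ball x r))
    {N : Finset X} {R : ℝ} (hR : 0 < R) (hN : ∀ y ∈ N, ∀ z ∈ N, y ≠ z → R / 8 ≤ dist y z)
    {w : X} (hw : ∀ y ∈ N, dist y w < 3 * R) : (N.card : ℝ≥0∞) ≤ D ^ 7 := by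
  have hpos : υ (ball w (4 * R)) ≠ 0 := measure_ball_pos_of_doubling hD w (by positivity)
  have h1 : ∑ y ∈ N, υ (ball w (4 * R)) ≤ D ^ 7 * υ (ball w (4 * R)) := by
    calc ∑ y ∈ N, υ (ball w (4 * R)) ≤ ∑ y ∈ N, D ^ 6 * υ (ball y (R / 8)) := by
          refine Finset.sum_le_sum fun y hy => ?_
          refine measure_ball_le_of_dist_add_le hD (by positivity) 6 ?_
          rw [dist_comm]
          linarith [hw y hy]
      _ = D ^ 6 * ∑ y ∈ N, υ (ball y (R / 8)) := by rw [Finset.mul_sum]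
      _ ≤ D ^ 6 * (D * υ (ball w (4 * R))) := by
          gcongr
          refine sum_measure_ball_le_of_separated hD (by positivity) hN fun y hy => ?_
          linarith [hw y hy]
      _ = D ^ 7 * υ (ball w (4 * R)) := by ring
  rw [Finset.sum_const, nsmul_eq_mul] at h1
  exact (ENNReal.mul_le_mul_iff_left hpos (measure_ne_top _ _)).1 h1

lemma sum_setLIntegral_ball_le [CompactSpace X] [NeZero υ] [IsFiniteMeasure υ]
    (hD : ∀ x : X, ∀ r : ℝ, 0 < r → υ (ball x (2 * r)) ≤ D * υ (ball x r))
    {N : Finset X} {R : ℝ} (hR : 0 < R) (hN : ∀ y ∈ N, ∀ z ∈ N, y ≠ z → R / 8 ≤ dist y z)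
    {g : X → ℝ≥0∞} (hg : Measurable g) {B : Set X} (hB : MeasurableSet B)
    (hNB : ∀ z ∈ N, ball z (3 * R) ⊆ B) :
    ∑ z ∈ N, ∫⁻ w in ball z (3 * R), g w ∂υ ≤ D ^ 7 * ∫⁻ w in B, g w ∂υ := by
  simp_rw [← lintegral_indicator measurableSet_ball]
  rw [← lintegral_finsetSum _ fun z _ => hg.indicator measurableSet_ball,
    ← lintegral_indicator hB, ← lintegral_const_mul _ (hg.indicator hB)]
  refine lintegral_mono fun w => ?_
  have h1 : ∑ z ∈ N, (ball z (3 * R)).indicator g w =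
      ∑ z ∈ N with w ∈ ball z (3 * R), g w := by
    rw [Finset.sum_filter]
    rfl
  simp only [h1]
  rw [Finset.sum_const, nsmul_eq_mul]
  by_cases hw : w ∈ B
  · rw [indicator_of_mem hw]
    gcongr
    refine card_separated_le hD (w := w) hR (fun y hy z hz => hN y (Finset.mem_filter.1 hy).1 z
      (Finset.mem_filter.1 hz).1) fun y hy => ?_
    rw [dist_comm]
    exact (Finset.mem_filter.1 hy).2
  · rw [Finset.filter_false_of_mem fun z hz h => hw (hNB z hz h)]
    simp

/-- A weak `(1,1)`-Poincaré inequality improves to one with the same ball on both sides in a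
geodesic space with a doubling measure. -/
theorem exists_setLIntegral_enorm_sub_le_of_weak [CompactSpace X] [NeZero υ] [IsFiniteMeasure υ]
    (hX : IsGeodesicSpace X)
    (hD : ∀ x : X, ∀ r : ℝ, 0 < r → υ (ball x (2 * r)) ≤ D * υ (ball x r))
    {f : X → ℝ} (hf : Measurable f) {g : X → ℝ≥0∞} (hg : Measurable g)
    (hweak : ∀ x : X, ∀ r : ℝ, 0 < r → ∃ c : ℝ,
      ∫⁻ y in ball x r, ‖f y - c‖ₑ ∂υ ≤ ENNReal.ofReal r * ∫⁻ y in ball x (3 * r), g y ∂υ)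
    (x : X) {r : ℝ} (hr : 0 < r) :
    ∃ c : ℝ, ∫⁻ y in ball x r, ‖f y - c‖ₑ ∂υ ≤
      3 * D ^ 15 * ENNReal.ofReal (2 * r) * ∫⁻ y in ball x r, g y ∂υ := by
  have hweak' : ∀ x : X, ∀ r : ℝ, ∃ c : ℝ, 0 < r →
      ∫⁻ y in ball x r, ‖f y - c‖ₑ ∂υ ≤ ENNReal.ofReal r * ∫⁻ y in ball x (3 * r), g y ∂υ := by
    intro x r
    by_cases h : 0 < r
    · obtain ⟨c, hc⟩ := hweak x r h
      exact ⟨c, fun _ => hc⟩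
    · exact ⟨0, fun h' => absurd h' h⟩
  choose m hm using hweak'
  set R := chainRadius r with hR
  have hRpos : ∀ j, 0 < R j := chainRadius_pos hr
  choose N hNs hNsep hNcov using fun j =>
    exists_finset_separated_net {p : X | dist x p ≤ r - 3 * R j}
      (show 0 < R j / 8 by linarith [hRpos j])
  have hN0 : ∀ z ∈ N 0, z = x := fun z hz => by
    have h : dist x z ≤ r - 3 * R 0 := hNs 0 z hz
    rw [hR, chainRadius_zero] at h
    exact (dist_le_zero.1 (h.trans (by linarith))).symm
  set G := ∫⁻ y in ball x r, g y ∂υ with hG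
  set E : ℕ → X → ℝ≥0∞ := fun j z => (∫⁻ w in ball z (R j), ‖f w - m z (R j)‖ₑ ∂υ) /
    υ (ball z (R j)) with hE
  have hEle : ∀ j, ∑ z ∈ N j, υ (ball z (R j)) * E j z ≤ ENNReal.ofReal (R j) * (D ^ 7 * G) := by
    intro j
    calc ∑ z ∈ N j, υ (ball z (R j)) * E j z
        ≤ ∑ z ∈ N j, ENNReal.ofReal (R j) * ∫⁻ w in ball z (3 * R j), g w ∂υ := by
          refine Finset.sum_le_sum fun z _ => ?_
          rw [ENNReal.mul_div_cancel (measure_ball_pos_of_doubling hD _ (hRpos j))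
            (measure_ne_top _ _)]
          exact hm z (R j) (hRpos j)
      _ ≤ ENNReal.ofReal (R j) * (D ^ 7 * G) := by
          rw [← Finset.mul_sum]
          gcongr
          refine sum_setLIntegral_ball_le hD (hRpos j) (hNsep j) hg measurableSet_ball
            fun z hz => ball_subset_ball' ?_
          have h : dist x z ≤ r - 3 * R j := hNs j z hz
          rw [dist_comm]
          linarith
  have hK : ∀ K, ∫⁻ y in closedBall x (r - 3 * R K), ‖f y - m x (R 0)‖ₑ ∂υ ≤
      3 * D ^ 15 * ENNReal.ofReal (2 * r) * G := by
    intro K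
    have hch : ∀ y : X, ∃ a : ℕ → X, y ∈ N K → (∀ j, a j ∈ N j) ∧
        (∀ j, dist y (a j) ≤ 3 * R j + R j / 8) ∧ dist y (a K) < R K / 8 ∧
        ∀ j, dist (a j) (a (j + 1)) ≤ R j / 2 + R j / 8 + R (j + 1) / 8 := by
      intro y
      by_cases hy : y ∈ N K
      · obtain ⟨a, ha⟩ := exists_chain hX hr hNcov K (hNs K y hy)
        exact ⟨a, fun _ => ha⟩
      · exact ⟨fun _ => y, fun h => absurd h hy⟩
    choose a ha using hch
    have hshadow : ∀ j ∈ Finset.range (K + 1), ∀ z ∈ N j,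
        ∑ y ∈ N K with a y j = z, υ (ball y (R K / 8)) ≤ D ^ 3 * υ (ball z (R j)) := by
      intro j hj z _
      have hRK : R K ≤ R j := chainRadius_antitone hr (Nat.lt_succ_iff.1 (Finset.mem_range.1 hj))
      have h1 : ∑ y ∈ N K with a y j = z, υ (ball y (R K / 8)) ≤ D * υ (ball z (4 * R j)) := by
        refine sum_measure_ball_le_of_separated hD (by linarith [hRpos K])
          (fun y hy w hw => hNsep K y (Finset.mem_filter.1 hy).1 w (Finset.mem_filter.1 hw).1)
          fun y hy => ?_
        obtain ⟨hyN, rfl⟩ := Finset.mem_filter.1 hy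
        linarith [(ha y hyN).2.1 j, hRpos j]
      calc _ ≤ D * υ (ball z (4 * R j)) := h1
        _ ≤ D * (D ^ 2 * υ (ball z (R j))) := by
            gcongr
            exact measure_ball_le_of_dist_add_le hD (hRpos j) 2 (by rw [dist_self]; linarith)
        _ = _ := by ring
    calc ∫⁻ y in closedBall x (r - 3 * R K), ‖f y - m x (R 0)‖ₑ ∂υ
        ≤ ∫⁻ w in ⋃ y ∈ N K, ball y (R K / 8), ‖f w - m x (R 0)‖ₑ ∂υ := by
          refine lintegral_mono_set fun p hp => ?_
          obtain ⟨z, hz, hpz⟩ := hNcov K p (by rwa [mem_ofPred_eq, dist_comm])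
          exact mem_iUnion₂.2 ⟨z, hz, hpz⟩
      _ ≤ ∑ y ∈ N K, ∫⁻ w in ball y (R K / 8), ‖f w - m x (R 0)‖ₑ ∂υ :=
          setLIntegral_biUnion_finset_le _ _ _
      _ ≤ ∑ y ∈ N K, υ (ball y (R K / 8)) *
            (3 * D ^ 5 * ∑ j ∈ Finset.range (K + 1), E j (a y j)) := by
          refine Finset.sum_le_sum fun y hy => ?_
          obtain ⟨h1, -, h3, h4⟩ := ha y hy
          have := setLIntegral_enorm_sub_le_sum_chain hD hf m hr K h3 h4
          rwa [hN0 _ (h1 0)] at this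
      _ = 3 * D ^ 5 * ∑ j ∈ Finset.range (K + 1), ∑ y ∈ N K,
            υ (ball y (R K / 8)) * E j (a y j) := by
          rw [Finset.sum_comm, Finset.mul_sum]
          refine Finset.sum_congr rfl fun y _ => ?_
          rw [← Finset.mul_sum]
          ring
      _ ≤ 3 * D ^ 5 * ∑ j ∈ Finset.range (K + 1), D ^ 3 * (ENNReal.ofReal (R j) * (D ^ 7 * G)) := by
          gcongr with j hj
          calc ∑ y ∈ N K, υ (ball y (R K / 8)) * E j (a y j)
              = ∑ z ∈ N j, ∑ y ∈ N K with a y j = z, υ (ball y (R K / 8)) * E j (a y j) :=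
                (Finset.sum_fiberwise_of_maps_to (fun y hy => (ha y hy).1 j) _).symm
            _ = ∑ z ∈ N j, (∑ y ∈ N K with a y j = z, υ (ball y (R K / 8))) * E j z := by
                refine Finset.sum_congr rfl fun z _ => ?_
                rw [Finset.sum_mul]
                refine Finset.sum_congr rfl fun y hy => ?_
                rw [(Finset.mem_filter.1 hy).2]
            _ ≤ ∑ z ∈ N j, D ^ 3 * υ (ball z (R j)) * E j z := by
                gcongr with z hz
                exact hshadow j hj z hz
            _ = D ^ 3 * ∑ z ∈ N j, υ (ball z (R j)) * E j z := by
                simp_rw [Finset.mul_sum, mul_assoc]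
            _ ≤ _ := by
                gcongr
                exact hEle j
      _ = 3 * D ^ 15 * (∑ j ∈ Finset.range (K + 1), ENNReal.ofReal (R j)) * G := by
          rw [← Finset.mul_sum, ← Finset.sum_mul]
          ring
      _ ≤ 3 * D ^ 15 * ENNReal.ofReal (2 * r) * G := by
          gcongr
          rw [← ENNReal.ofReal_sum_of_nonneg fun j _ => (hRpos j).le]
          exact ENNReal.ofReal_le_ofReal (sum_chainRadius_le hr _)
  refine ⟨m x (R 0), ?_⟩
  have hunion : ball x r = ⋃ K, closedBall x (r - 3 * R K) := by
    ext y
    simp only [mem_ball, mem_iUnion, mem_closedBall]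
    constructor
    · intro hy
      obtain ⟨K, hK⟩ := exists_pow_lt_of_lt_one (show 0 < (r - dist y x) / r from
        div_pos (by linarith) hr) (show (5 / 6 : ℝ) < 1 by norm_num)
      refine ⟨K, ?_⟩
      rw [lt_div_iff₀ hr] at hK
      simp only [hR, chainRadius]
      linarith
    · rintro ⟨K, hK⟩
      linarith [hRpos K]
  rw [hunion, setLIntegral_iUnion_of_directed]
  · exact iSup_le hK
  · refine Monotone.directed_le fun i j hij => closedBall_subset_closedBall ?_
    have : R j ≤ R i := chainRadius_antitone hr hij
    linarith

end Doubling

section PointwiseLipschitz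

variable {f : X → ℝ} {K : ℝ≥0}

lemma bddAbove_slope_image (hf : LipschitzWith K f) (x : X) (s : Set X) :
    BddAbove ((fun y => |f x - f y| / dist x y) '' s) := by
  refine ⟨K, ?_⟩
  rintro _ ⟨y, -, rfl⟩
  refine div_le_of_le_mul₀ dist_nonneg K.2 ?_
  rw [← Real.dist_eq]
  exact hf.dist_le_mul x y

lemma sSup_slope_image_nonneg (f : X → ℝ) (x : X) (s : Set X) :
    0 ≤ sSup ((fun y => |f x - f y| / dist x y) '' s) := by
  refine Real.sSup_nonneg ?_
  rintro _ ⟨y, -, rfl⟩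
  positivity

lemma sSup_slope_image_mono (hf : LipschitzWith K f) (x : X) {s t : Set X} (hst : s ⊆ t) :
    sSup ((fun y => |f x - f y| / dist x y) '' s) ≤
      sSup ((fun y => |f x - f y| / dist x y) '' t) := by
  rcases s.eq_empty_or_nonempty with rfl | hs
  · rw [image_empty, Real.sSup_empty]
    exact sSup_slope_image_nonneg f x t
  · exact csSup_le_csSup (bddAbove_slope_image hf x t) (hs.image _) (image_mono hst)

lemma pLip_nonneg (f : X → ℝ) (x : X) : 0 ≤ pLip f x := by
  unfold pLip
  split_ifs
  · exact le_rfl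
  · exact Real.iInf_nonneg fun r => sSup_slope_image_nonneg f x _

lemma bddBelow_range_slope (f : X → ℝ) (x : X) :
    BddBelow (range fun r : Ioi (0 : ℝ) =>
      sSup ((fun y => |f x - f y| / dist x y) '' (ball x r.1 \ {x}))) :=
  ⟨0, by rintro _ ⟨r, rfl⟩; exact sSup_slope_image_nonneg f x _⟩

lemma pLip_le (hf : LipschitzWith K f) (x : X) : pLip f x ≤ K := by
  unfold pLip
  split_ifs
  · exact K.2
  · refine (ciInf_le (bddBelow_range_slope f x) ⟨1, mem_Ioi.2 one_pos⟩).trans ?_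
    refine Real.sSup_le ?_ K.2
    rintro _ ⟨y, -, rfl⟩
    refine div_le_of_le_mul₀ dist_nonneg K.2 ?_
    rw [← Real.dist_eq]
    exact hf.dist_le_mul x y

lemma measurable_sSup_slope [MeasurableSpace X] [BorelSpace X] (hf : LipschitzWith K f) (r : ℝ) :
    Measurable fun x => sSup ((fun y => |f x - f y| / dist x y) '' (ball x r \ {x})) := by
  refine measurable_of_Ioi fun c => ?_
  rcases lt_or_ge c 0 with hc | hc
  · convert MeasurableSet.univ
    refine eq_univ_of_forall fun x => ?_
    exact hc.trans_le (sSup_slope_image_nonneg f x _)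
  · have h : (fun x => sSup ((fun y => |f x - f y| / dist x y) '' (ball x r \ {x}))) ⁻¹' Ioi c =
        ⋃ y, {x | x ≠ y ∧ dist y x < r ∧ c * dist x y < |f x - f y|} := by
      ext x
      simp only [mem_preimage, mem_Ioi, mem_iUnion]
      constructor
      · intro hx
        have hne : ((fun y => |f x - f y| / dist x y) '' (ball x r \ {x})).Nonempty := by
          by_contra hemp
          rw [not_nonempty_iff_eq_empty.1 hemp, Real.sSup_empty] at hx
          linarith
        obtain ⟨_, ⟨y, ⟨hy1, hy2⟩, rfl⟩, hy⟩ := exists_lt_of_lt_csSup hne hx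
        have hxy : x ≠ y := fun h => hy2 h.symm
        exact ⟨y, hxy, hy1, (lt_div_iff₀ (dist_pos.2 hxy)).1 hy⟩
      · rintro ⟨y, hxy, hy1, hy⟩
        exact ((lt_div_iff₀ (dist_pos.2 hxy)).2 hy).trans_le
          (le_csSup (bddAbove_slope_image hf x _) ⟨y, ⟨hy1, fun h => hxy h.symm⟩, rfl⟩)
    rw [h]
    refine (isOpen_iUnion fun y => ?_).measurableSet
    have hfc := hf.continuous
    have h1 : IsOpen {x : X | x ≠ y} := isOpen_ne
    have h2 : IsOpen {x : X | dist y x < r} := isOpen_lt (by fun_prop) (by fun_prop)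
    have h3 : IsOpen {x : X | c * dist x y < |f x - f y|} :=
      isOpen_lt (by fun_prop) (by fun_prop)
    exact h1.inter (h2.inter h3)

lemma measurable_pLip [MeasurableSpace X] [BorelSpace X] (hf : LipschitzWith K f) :
    Measurable (pLip f) := by
  have h : pLip f = fun x => if x ∈ {x : X | 𝓝[≠] x = ⊥} then 0 else
      ⨅ n : ℕ, sSup ((fun y => |f x - f y| / dist x y) '' (ball x (1 / ((n : ℝ) + 1)) \ {x})) := by
    funext x
    unfold pLip
    refine if_congr Iff.rfl rfl (le_antisymm ?_ ?_)
    · exact le_ciInf fun n =>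
        ciInf_le (bddBelow_range_slope f x) ⟨1 / ((n : ℝ) + 1), mem_Ioi.2 Nat.one_div_pos_of_nat⟩
    · have : Nonempty (Ioi (0 : ℝ)) := ⟨⟨1, mem_Ioi.2 one_pos⟩⟩
      refine le_ciInf fun r => ?_
      obtain ⟨n, hn⟩ := exists_nat_one_div_lt (mem_Ioi.1 r.2)
      refine (ciInf_le ⟨0, ?_⟩ n).trans (sSup_slope_image_mono hf x
        (sdiff_subset_sdiff_left (ball_subset_ball hn.le)))
      rintro _ ⟨k, rfl⟩
      exact sSup_slope_image_nonneg f x _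
  rw [h]
  refine Measurable.ite ?_ measurable_const (Measurable.iInf fun n => measurable_sSup_slope hf _)
  have h2 : {x : X | 𝓝[≠] x = ⊥} = ⋃ x ∈ {x : X | IsOpen ({x} : Set X)}, {x} := by
    ext x
    simp [isOpen_singleton_iff_punctured_nhds]
  rw [h2]
  exact (isOpen_biUnion fun x hx => hx).measurableSet

/-- Along a minimal geodesic, the derivative of a Lipschitz function is bounded by its pointwise
Lipschitz constant. -/
lemma abs_deriv_comp_le_pLip (hf : LipschitzWith K f) {γ : ℝ → X} {x y : X}
    (hγ : IsMinGeodesic γ x y) {s : ℝ} (hs : s ∈ Ioo 0 (dist x y))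
    (hd : DifferentiableAt ℝ (f ∘ γ) s) : |deriv (f ∘ γ) s| ≤ pLip f (γ s) := by
  have hIcc : ∀ᶠ t in 𝓝[≠] s, t ∈ Ioo 0 (dist x y) :=
    nhdsWithin_le_nhds (Ioo_mem_nhds hs.1 hs.2)
  have hdist : ∀ t ∈ Ioo 0 (dist x y), dist (γ s) (γ t) = |s - t| := fun t ht =>
    hγ.2.2 s (Ioo_subset_Icc_self hs) t (Ioo_subset_Icc_self ht)
  have hnear : ∀ r > 0, ∀ᶠ t in 𝓝[≠] s, γ t ∈ ball (γ s) r \ {γ s} := by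
    intro r hr
    filter_upwards [hIcc, nhdsWithin_le_nhds (ball_mem_nhds s hr), self_mem_nhdsWithin]
      with t ht htr hts
    refine ⟨?_, fun h => ?_⟩
    · rw [mem_ball, dist_comm, hdist t ht, ← Real.dist_eq, dist_comm]
      exact htr
    · have h1 := hdist t ht
      rw [mem_singleton_iff.1 h, dist_self] at h1
      exact hts (sub_eq_zero.1 (abs_eq_zero.1 h1.symm)).symm
  have hbot : 𝓝[≠] γ s ≠ ⊥ := by
    intro h
    have h1 : ({γ s} : Set X) ∈ 𝓝 (γ s) :=
      (isOpen_singleton_iff_punctured_nhds (γ s)).2 h |>.mem_nhds rfl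
    obtain ⟨r, hr, hsub⟩ := Metric.mem_nhds_iff.1 h1
    obtain ⟨t, ht⟩ := (hnear r hr).exists
    exact ht.2 (hsub ht.1)
  unfold pLip
  rw [if_neg hbot]
  have : Nonempty (Ioi (0 : ℝ)) := ⟨⟨1, mem_Ioi.2 one_pos⟩⟩
  refine le_ciInf fun r => ?_
  have hlim := (hasDerivAt_iff_tendsto_slope.1 hd.hasDerivAt).abs
  refine le_of_tendsto hlim ?_
  filter_upwards [hIcc, hnear r.1 r.2] with t ht htr
  refine le_csSup (bddAbove_slope_image hf (γ s) _) ⟨γ t, htr, ?_⟩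
  simp only [hdist t ht, slope_def_field, Function.comp_apply, abs_div]
  rw [abs_sub_comm, abs_sub_comm s t]

/-- The pointwise Lipschitz constant is an upper gradient along minimal geodesics. -/
lemma enorm_sub_le_segF (hf : LipschitzWith K f) (x y : X) :
    ‖f x - f y‖ₑ ≤ segF (fun z => ENNReal.ofReal (pLip f z)) x y := by
  refine le_iInf₂ fun γ hγ => ?_
  have hγ' : IsMinGeodesic γ x y := hγ
  set d := dist x y with hd
  have hd0 : 0 ≤ d := dist_nonneg
  have hL : LipschitzOnWith K (f ∘ γ) (uIcc 0 d) := by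
    rw [uIcc_of_le hd0]
    refine LipschitzOnWith.of_dist_le_mul fun s hs t ht => ?_
    rw [Real.dist_eq s t, ← hγ'.2.2 s hs t ht]
    exact hf.dist_le_mul _ _
  have hAC := hL.absolutelyContinuousOnInterval
  have hFTC := hAC.integral_deriv_eq_sub
  rw [Function.comp_apply, Function.comp_apply, hγ'.1, hγ'.2.1,
    intervalIntegral.integral_of_le hd0] at hFTC
  rw [← enorm_neg, neg_sub, ← hFTC]
  refine (enorm_integral_le_lintegral_enorm _).trans ?_
  rw [← restrict_Ioo_eq_restrict_Ioc, ← restrict_Ioo_eq_restrict_Icc]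
  refine lintegral_mono_ae ?_
  filter_upwards [ae_restrict_of_ae hAC.ae_differentiableAt, ae_restrict_mem measurableSet_Ioo]
    with s hs1 hs2
  rw [Real.enorm_eq_ofReal_abs]
  refine ENNReal.ofReal_le_ofReal (abs_deriv_comp_le_pLip hf hγ' hs2 (hs1 ?_))
  rw [uIcc_of_le hd0]
  exact Ioo_subset_Icc_self hs2

end PointwiseLipschitz

/-- Replacing an arbitrary constant by the average costs a factor `2`. -/
lemma setIntegral_abs_sub_setAverage_le {α : Type*} [MeasurableSpace α] {υ : Measure α}
    [IsFiniteMeasure υ] {f : α → ℝ} {s : Set α} (h0 : υ s ≠ 0) (hf : IntegrableOn f s υ) (c : ℝ) :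
    ∫ y in s, |f y - ⨍ z in s, f z ∂υ| ∂υ ≤ 2 * ∫ y in s, |f y - c| ∂υ := by
  set a := ⨍ z in s, f z ∂υ with ha
  have hfc : IntegrableOn (fun y => |f y - c|) s υ := (hf.sub (integrable_const c)).abs
  have hc : ∀ b : ℝ, IntegrableOn (fun _ => b) s υ := fun b => integrable_const b
  have hpos : 0 < υ.real s := ENNReal.toReal_pos h0 (measure_ne_top _ _)
  have h1 : υ.real s * |c - a| ≤ ∫ y in s, |f y - c| ∂υ := by
    have h2 : ∫ y in s, (f y - c) ∂υ = υ.real s * (a - c) := by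
      rw [integral_sub hf (hc c), setIntegral_const, ha, setAverage_eq, smul_eq_mul, smul_eq_mul,
        mul_sub, mul_inv_cancel_left₀ hpos.ne']
    calc υ.real s * |c - a| = |∫ y in s, (f y - c) ∂υ| := by
          rw [h2, abs_mul, abs_of_pos hpos, abs_sub_comm]
      _ ≤ _ := abs_integral_le_integral_abs
  calc ∫ y in s, |f y - a| ∂υ ≤ ∫ y in s, (|f y - c| + |c - a|) ∂υ :=
        integral_mono (hf.sub (hc a)).abs (hfc.add (hc _))
          fun y => abs_sub_le _ _ _
    _ = ∫ y in s, |f y - c| ∂υ + υ.real s * |c - a| := by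
        rw [integral_add hfc (hc _), setIntegral_const, smul_eq_mul]
    _ ≤ _ := by linarith

section SegmentInequality

variable [CompactSpace X] [MeasurableSpace X] [BorelSpace X] {υ : Measure X} {f : X → ℝ} {K : ℝ≥0}

/-- The segment inequality implies a weak `(1,1)`-Poincaré inequality. -/
lemma exists_setLIntegral_enorm_sub_le_of_segmentIneq [IsFiniteMeasure υ] {lam : ℝ}
    (hseg : SegmentIneqFor υ lam) (hf : LipschitzWith K f) (x : X) {r : ℝ} (hr : 0 < r)
    (h0 : υ (ball x r) ≠ 0) :
    ∃ c : ℝ, ∫⁻ y in ball x r, ‖f y - c‖ₑ ∂υ ≤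
      ENNReal.ofReal r * ∫⁻ y in ball x (3 * r),
        ENNReal.ofReal lam * ENNReal.ofReal (pLip f y) ∂υ := by
  have hmeas : Measurable fun p : X × X => ‖f p.1 - f p.2‖ₑ := by
    have := hf.continuous.measurable
    fun_prop
  have hg : Measurable fun z => ENNReal.ofReal (pLip f z) := (measurable_pLip hf).ennreal_ofReal
  obtain ⟨z, -, hz⟩ := exists_le_setLAverage (μ := υ) h0 (measure_ne_top _ _)
    (f := fun z => ∫⁻ y in ball x r, ‖f z - f y‖ₑ ∂υ) hmeas.lintegral_prod_right'.aemeasurable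
  refine ⟨f z, ?_⟩
  have hfub : ∫⁻ z in ball x r, ∫⁻ y in ball x r, ‖f z - f y‖ₑ ∂υ ∂υ ≤
      ENNReal.ofReal (lam * r) * υ (ball x r) *
        ∫⁻ y in ball x (3 * r), ENNReal.ofReal (pLip f y) ∂υ := by
    calc ∫⁻ z in ball x r, ∫⁻ y in ball x r, ‖f z - f y‖ₑ ∂υ ∂υ
        = ∫⁻ p in ball x r ×ˢ ball x r, ‖f p.1 - f p.2‖ₑ ∂(υ.prod υ) := by
          rw [← Measure.prod_restrict, lintegral_prod _ hmeas.aemeasurable]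
      _ ≤ ∫⁻ p in ball x r ×ˢ ball x r,
            segF (fun z => ENNReal.ofReal (pLip f z)) p.1 p.2 ∂(υ.prod υ) :=
          lintegral_mono fun p => enorm_sub_le_segF hf p.1 p.2
      _ ≤ _ := hseg x r hr _ hg
  calc ∫⁻ y in ball x r, ‖f y - f z‖ₑ ∂υ = ∫⁻ y in ball x r, ‖f z - f y‖ₑ ∂υ := by
        refine lintegral_congr fun y => ?_
        rw [← enorm_neg, neg_sub]
    _ ≤ _ := hz
    _ ≤ (ENNReal.ofReal (lam * r) * υ (ball x r) *
        ∫⁻ y in ball x (3 * r), ENNReal.ofReal (pLip f y) ∂υ) / υ (ball x r) := by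
        rw [setLAverage_eq]
        gcongr
    _ = ENNReal.ofReal (lam * r) * ∫⁻ y in ball x (3 * r), ENNReal.ofReal (pLip f y) ∂υ := by
        rw [mul_right_comm, ENNReal.mul_div_cancel_right h0 (measure_ne_top _ _)]
    _ = _ := by
        rw [lintegral_const_mul _ hg, mul_comm lam r, ENNReal.ofReal_mul hr.le, mul_assoc]

end SegmentInequality

/-- doubling + segment inequality implies a (1,1)-Poincaré inequality. -/
theorem stmt12 :
    ∀ κ : ℝ, 0 < κ → ∀ lam : ℝ, 0 < lam →
      ∃ τ : ℝ, 0 < τ ∧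
        ∀ (X : Type) [MetricSpace X] [CompactSpace X] [MeasurableSpace X] [BorelSpace X]
          (υ : Measure X), IsProbabilityMeasure υ → IsGeodesicSpace X →
          DoublingFor υ κ → SegmentIneqFor υ lam → PoincareFor υ 1 1 τ := by
  intro κ _ lam hlam
  set D : ℝ≥0∞ := (2 : ℝ≥0∞) ^ κ
  have hDtop : D ≠ ⊤ := ENNReal.rpow_ne_top_of_nonneg (by positivity) (by simp)
  have hD0 : D ≠ 0 := (ENNReal.rpow_pos (by simp) (by simp)).ne'
  have hAtop : 3 * D ^ 15 ≠ ⊤ := ENNReal.mul_ne_top (by simp) (ENNReal.pow_ne_top hDtop)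
  have hApos : 0 < (3 * D ^ 15).toReal :=
    ENNReal.toReal_pos (mul_ne_zero (by simp) (pow_ne_zero _ hD0)) hAtop
  refine ⟨4 * (3 * D ^ 15).toReal * lam, by positivity, ?_⟩
  intro X _ _ _ _ υ hυ hX hD hseg x r hr f ⟨K, hf⟩
  have hball : ∀ x : X, ∀ r : ℝ, 0 < r → υ (ball x r) ≠ 0 := fun x r hr =>
    measure_ball_pos_of_doubling hD x hr
  have hg : Measurable fun z => ENNReal.ofReal (pLip f z) := (measurable_pLip hf).ennreal_ofReal
  obtain ⟨c, hc⟩ := exists_setLIntegral_enorm_sub_le_of_weak hX hD hf.continuous.measurable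
    (hg.const_mul (ENNReal.ofReal lam)) (fun x r hr =>
      exists_setLIntegral_enorm_sub_le_of_segmentIneq hseg hf x hr (hball x r hr)) x hr
  have hfc : Integrable f υ := hf.continuous.integrable_of_hasCompactSupport (.of_compactSpace f)
  have hP : Integrable (pLip f) υ :=
    Integrable.of_bound (measurable_pLip hf).aestronglyMeasurable K (ae_of_all _ fun y => by
      rw [Real.norm_of_nonneg (pLip_nonneg f y)]
      exact pLip_le hf y)
  have hP0 : 0 ≤ ∫ y in ball x r, pLip f y ∂υ := integral_nonneg fun y => pLip_nonneg f y
  have hI : ∫ y in ball x r, |f y - c| ∂υ ≤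
      (3 * D ^ 15).toReal * (2 * r) * (lam * ∫ y in ball x r, pLip f y ∂υ) := by
    rw [lintegral_const_mul _ hg, ← ofReal_integral_eq_lintegral_ofReal hP.integrableOn
      (ae_of_all _ fun y => pLip_nonneg f y)] at hc
    have h1 := ENNReal.toReal_mono (ENNReal.mul_ne_top (ENNReal.mul_ne_top hAtop
      ENNReal.ofReal_ne_top) (ENNReal.mul_ne_top ENNReal.ofReal_ne_top ENNReal.ofReal_ne_top)) hc
    have h3 : AEStronglyMeasurable (fun y => f y - c) (υ.restrict (ball x r)) :=
      (hf.continuous.sub continuous_const).aestronglyMeasurable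
    rw [← integral_norm_eq_lintegral_enorm h3,
      ENNReal.toReal_mul, ENNReal.toReal_mul (a := 3 * D ^ 15),
      ENNReal.toReal_mul (a := ENNReal.ofReal lam),
      ENNReal.toReal_ofReal (by positivity), ENNReal.toReal_ofReal hlam.le,
      ENNReal.toReal_ofReal hP0] at h1
    exact h1
  have h2 := setIntegral_abs_sub_setAverage_le (hball x r hr) hfc.integrableOn c
  simp only [Real.rpow_one, div_one]
  rw [setAverage_eq, setAverage_eq _ (pLip f), smul_eq_mul, smul_eq_mul, mul_left_comm]
  gcongr
  linarith
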